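/- Suppose Assumption 1 holds, ‖A₀‖, ‖A₁‖ ≤ 1 (spectral norm), ‖b₀‖, ‖b₁‖ ≤ 1, |c₀|, |c₁| ≤ 1, Γ ⊆ [0, ζ] with ζ ≥ 1, 0 < μ̃ ≤ 1, and ε ∈ (0,1). Suppose γ* maximizes d over ℝ₊, λ_min(A(γ*)) ≥ μ̃, and γ* ∈ [γ⁽¹⁾, γ⁽²⁾] ⊆ ℝ₊. If x̄ ∈ ℝⁿ satisfies max(q(γ⁽¹⁾, x̄), q(γ⁽²⁾, x̄)) ≤ Opt + μ̃ (εμ̃/(10ζ))², then x̄ is an ε-approximate solution of the GTRS: q₀(x̄) ≤ Opt + ε and q₁(x̄) ≤ ε. -/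

import Mathlib

open Matrix Set

/-- The quadratic function `x ↦ xᵀ A x + 2 bᵀ x + c`. -/
noncomputable def quadF {n : ℕ} (A : Matrix (Fin n) (Fin n) ℝ) (b : Fin n → ℝ) (c : ℝ)
    (x : Fin n → ℝ) : ℝ :=
  x ⬝ᵥ (A *ᵥ x) + 2 * (b ⬝ᵥ x) + c

/-- Euclidean norm of a vector in `ℝⁿ`. -/
noncomputable def eNorm {n : ℕ} (x : Fin n → ℝ) : ℝ :=
  Real.sqrt (x ⬝ᵥ x)

/-- Spectral (ℓ²-operator) norm of a matrix. -/
noncomputable def sNorm {n : ℕ} (A : Matrix (Fin n) (Fin n) ℝ) : ℝ :=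
  ‖Matrix.toEuclideanCLM (𝕜 := ℝ) A‖

/-- The dual function `d(γ) = inf_x q₀(x) + γ q₁(x)`, valued in the extended reals. -/
noncomputable def dualF {n : ℕ} (A₀ A₁ : Matrix (Fin n) (Fin n) ℝ) (b₀ b₁ : Fin n → ℝ)
    (c₀ c₁ : ℝ) (γ : ℝ) : EReal :=
  ⨅ x : Fin n → ℝ, ((quadF A₀ b₀ c₀ x + γ * quadF A₁ b₁ c₁ x : ℝ) : EReal)

/-- The smallest eigenvalue of a real symmetric matrix, characterized as
`λ_min(M) = max {t : M − tI ⪰ 0}` (via `sSup`). -/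
noncomputable def lambdaMin {n : ℕ} (M : Matrix (Fin n) (Fin n) ℝ) : ℝ :=
  sSup {t : ℝ | (M - t • (1 : Matrix (Fin n) (Fin n) ℝ)).PosSemidef}

/-! ### Euclidean norm estimates -/

lemma eNorm_eq_norm_toLp {n : ℕ} (x : Fin n → ℝ) : eNorm x = ‖WithLp.toLp 2 x‖ := by
  simp [eNorm, EuclideanSpace.norm_eq, dotProduct, sq]

lemma eNorm_nonneg {n : ℕ} (x : Fin n → ℝ) : 0 ≤ eNorm x := Real.sqrt_nonneg _

lemma eNorm_sq {n : ℕ} (x : Fin n → ℝ) : eNorm x ^ 2 = x ⬝ᵥ x :=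
  Real.sq_sqrt (Finset.sum_nonneg fun i _ => mul_self_nonneg (x i))

lemma eNorm_add_le {n : ℕ} (x y : Fin n → ℝ) : eNorm (x + y) ≤ eNorm x + eNorm y := by
  simpa [eNorm_eq_norm_toLp] using norm_add_le (WithLp.toLp 2 x) (WithLp.toLp 2 y)

lemma eNorm_smul {n : ℕ} (t : ℝ) (x : Fin n → ℝ) : eNorm (t • x) = |t| * eNorm x := by
  simp [eNorm_eq_norm_toLp, norm_smul]

lemma abs_dotProduct_le {n : ℕ} (x y : Fin n → ℝ) : |x ⬝ᵥ y| ≤ eNorm x * eNorm y := by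
  have h := abs_real_inner_le_norm (WithLp.toLp 2 y) (WithLp.toLp 2 x)
  rw [EuclideanSpace.inner_toLp_toLp] at h
  rw [eNorm_eq_norm_toLp, eNorm_eq_norm_toLp, mul_comm]
  simpa using h

lemma eNorm_mulVec_le {n : ℕ} (A : Matrix (Fin n) (Fin n) ℝ) (x : Fin n → ℝ) :
    eNorm (A *ᵥ x) ≤ sNorm A * eNorm x := by
  simpa [eNorm_eq_norm_toLp, sNorm] using
    (Matrix.toEuclideanCLM (𝕜 := ℝ) A).le_opNorm (WithLp.toLp 2 x)

lemma eNorm_mulVec_le_of_sNorm_le_one {n : ℕ} {A : Matrix (Fin n) (Fin n) ℝ}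
    (hA : sNorm A ≤ 1) (x : Fin n → ℝ) : eNorm (A *ᵥ x) ≤ eNorm x :=
  (eNorm_mulVec_le A x).trans (mul_le_of_le_one_left (eNorm_nonneg x) hA)

lemma abs_dotProduct_mulVec_le {n : ℕ} {A : Matrix (Fin n) (Fin n) ℝ}
    (hA : sNorm A ≤ 1) (x : Fin n → ℝ) : |x ⬝ᵥ (A *ᵥ x)| ≤ eNorm x ^ 2 := by
  rw [sq]
  exact (abs_dotProduct_le _ _).trans
    (mul_le_mul_of_nonneg_left (eNorm_mulVec_le_of_sNorm_le_one hA x) (eNorm_nonneg x))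

/-! ### Quadratic functions -/

lemma quadF_add_smul {n : ℕ} (A₀ A₁ : Matrix (Fin n) (Fin n) ℝ) (b₀ b₁ : Fin n → ℝ)
    (c₀ c₁ γ : ℝ) (x : Fin n → ℝ) :
    quadF (A₀ + γ • A₁) (b₀ + γ • b₁) (c₀ + γ * c₁) x =
      quadF A₀ b₀ c₀ x + γ * quadF A₁ b₁ c₁ x := by
  simp only [quadF, Matrix.add_mulVec, Matrix.smul_mulVec, dotProduct_add, add_dotProduct,
    dotProduct_smul, smul_dotProduct, smul_eq_mul]
  ring

lemma quadF_add {n : ℕ} {A : Matrix (Fin n) (Fin n) ℝ} (hA : A.IsSymm) (b : Fin n → ℝ)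
    (c : ℝ) (x h : Fin n → ℝ) :
    quadF A b c (x + h) = quadF A b c x + 2 * ((A *ᵥ x + b) ⬝ᵥ h) + h ⬝ᵥ (A *ᵥ h) := by
  have hs : x ⬝ᵥ (A *ᵥ h) = (A *ᵥ x) ⬝ᵥ h := by
    rw [dotProduct_mulVec, ← mulVec_transpose, hA.eq]
  have hs' : h ⬝ᵥ (A *ᵥ x) = (A *ᵥ x) ⬝ᵥ h := dotProduct_comm _ _
  simp only [quadF, mulVec_add, dotProduct_add, add_dotProduct, hs, hs']
  ring

lemma abs_quadF_add_sub_le {n : ℕ} {A : Matrix (Fin n) (Fin n) ℝ} (hA : A.IsSymm)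
    (hAn : sNorm A ≤ 1) (b : Fin n → ℝ) (c : ℝ) (x h : Fin n → ℝ) :
    |quadF A b c (x + h) - quadF A b c x| ≤
      2 * eNorm (A *ᵥ x + b) * eNorm h + eNorm h ^ 2 := by
  have h1 := abs_dotProduct_le (A *ᵥ x + b) h
  have h2 := abs_dotProduct_mulVec_le hAn h
  rw [abs_le] at h1 h2 ⊢
  rw [quadF_add hA]
  constructor <;> linarith [h1.1, h1.2, h2.1, h2.2]

lemma le_dotProduct_mulVec_of_le_lambdaMin {n : ℕ} {M : Matrix (Fin n) (Fin n) ℝ} {μ : ℝ}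
    (hμ : 0 < μ) (h : μ ≤ lambdaMin M) (x : Fin n → ℝ) :
    μ * eNorm x ^ 2 ≤ x ⬝ᵥ (M *ᵥ x) := by
  have hne : {t : ℝ | (M - t • (1 : Matrix (Fin n) (Fin n) ℝ)).PosSemidef}.Nonempty := by
    by_contra hne
    rw [lambdaMin, Set.not_nonempty_iff_eq_empty.mp hne, Real.sSup_empty] at h
    linarith
  have key : ∀ t < μ, t * eNorm x ^ 2 ≤ x ⬝ᵥ (M *ᵥ x) := fun t ht => by
    obtain ⟨s, hs, hts⟩ := exists_lt_of_lt_csSup hne (ht.trans_le h)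
    have hx := hs.dotProduct_mulVec_nonneg x
    simp only [star_trivial, sub_mulVec, smul_mulVec, one_mulVec, dotProduct_sub,
      dotProduct_smul, smul_eq_mul, ← eNorm_sq] at hx
    nlinarith [mul_le_mul_of_nonneg_right hts.le (sq_nonneg (eNorm x))]
  have hcont : Filter.Tendsto (fun t : ℝ => t * eNorm x ^ 2) (nhdsWithin μ (Set.Iio μ))
      (nhds (μ * eNorm x ^ 2)) :=
    ((continuous_id.mul continuous_const).tendsto μ).mono_left nhdsWithin_le_nhds
  exact le_of_tendsto hcont (eventually_nhdsWithin_of_forall key)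

lemma posDef_of_le_lambdaMin {n : ℕ} {M : Matrix (Fin n) (Fin n) ℝ} (hM : M.IsSymm) {μ : ℝ}
    (hμ : 0 < μ) (h : μ ≤ lambdaMin M) : M.PosDef := by
  refine Matrix.PosDef.of_dotProduct_mulVec_pos (by simpa [IsHermitian] using hM.eq) fun x hx => ?_
  have hx' : 0 < eNorm x := by
    rw [eNorm_eq_norm_toLp, norm_pos_iff]
    simpa using hx
  have := le_dotProduct_mulVec_of_le_lambdaMin hμ h x
  simp only [star_trivial]
  nlinarith [mul_pos hμ (pow_pos hx' 2)]

/-- A critical point of a strongly convex quadratic, with its norm bound. -/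
lemma exists_mulVec_add_eq_zero {n : ℕ} {M : Matrix (Fin n) (Fin n) ℝ} (hM : M.IsSymm) {μ : ℝ}
    (hμ : 0 < μ) (h : μ ≤ lambdaMin M) (b : Fin n → ℝ) :
    ∃ x, M *ᵥ x + b = 0 ∧ μ * eNorm x ≤ eNorm b := by
  have hdet : IsUnit M.det := (posDef_of_le_lambdaMin hM hμ h).det_pos.ne'.isUnit
  refine ⟨-(M⁻¹ *ᵥ b), by simp [mulVec_neg, mulVec_mulVec, mul_nonsing_inv _ hdet], ?_⟩
  set x := -(M⁻¹ *ᵥ b) with hx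
  have hMx : M *ᵥ x = -b := by simp [hx, mulVec_neg, mulVec_mulVec, mul_nonsing_inv _ hdet]
  have h1 := le_dotProduct_mulVec_of_le_lambdaMin hμ h x
  rw [hMx, dotProduct_neg] at h1
  have h2 := (abs_le.mp (abs_dotProduct_le x b)).1
  rcases (eNorm_nonneg x).eq_or_lt with h0 | h0
  · rw [← h0, mul_zero]
    exact eNorm_nonneg b
  · exact le_of_mul_le_mul_right (by nlinarith) h0

lemma quadF_add_of_mulVec_add_eq_zero {n : ℕ} {M : Matrix (Fin n) (Fin n) ℝ} (hM : M.IsSymm)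
    {b x : Fin n → ℝ} (hx : M *ᵥ x + b = 0) (c : ℝ) (h : Fin n → ℝ) :
    quadF M b c (x + h) = quadF M b c x + h ⬝ᵥ (M *ᵥ h) := by
  rw [quadF_add hM, hx, zero_dotProduct]
  ring

/-! ### Optimality conditions at a dual maximizer -/

/-- At a maximizer `γ` of the dual over `ℝ₊`, the minimizer `x` of the (strongly convex)
Lagrangian satisfies `q₁(x) * t ≤ 0` for every feasible direction `t`. -/
lemma quadF_mul_nonpos_of_dual_max {n : ℕ} {A₀ A₁ : Matrix (Fin n) (Fin n) ℝ}
    (hA₀ : A₀.IsSymm) (hA₁ : A₁.IsSymm) (hA₁n : sNorm A₁ ≤ 1)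
    {b₀ b₁ : Fin n → ℝ} {c₀ c₁ μ γ : ℝ} (hμ : 0 < μ)
    (hmax : ∀ γ' : ℝ, 0 ≤ γ' →
      dualF A₀ A₁ b₀ b₁ c₀ c₁ γ' ≤ dualF A₀ A₁ b₀ b₁ c₀ c₁ γ)
    (hlmin : μ ≤ lambdaMin (A₀ + γ • A₁)) {x : Fin n → ℝ}
    (hx : (A₀ + γ • A₁) *ᵥ x + (b₀ + γ • b₁) = 0) {t : ℝ} (hγ : 0 ≤ γ) (ht : 0 ≤ γ + t) :
    t * quadF A₁ b₁ c₁ x ≤ 0 := by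
  by_contra! hpos
  set s := quadF A₁ b₁ c₁ x
  set G := eNorm (A₁ *ᵥ x + b₁)
  have hM : (A₀ + γ • A₁).IsSymm := hA₀.add (hA₁.smul γ)
  obtain ⟨r, hr0, hr1, hrμ, hrs⟩ : ∃ r : ℝ, 0 < r ∧ r ≤ 1 ∧ r * |t| ≤ μ / 2 ∧
      r * (2 * t ^ 2 * G ^ 2) < μ * (t * s) := by
    have hden : 0 < μ * (t * s) := mul_pos hμ hpos
    have c1 : ∀ᶠ r : ℝ in nhdsWithin 0 (Set.Ioi 0), r < 1 :=
      nhdsWithin_le_nhds (Iio_mem_nhds one_pos)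
    have c2 : ∀ᶠ r : ℝ in nhdsWithin 0 (Set.Ioi 0), r * |t| < μ / 2 :=
      nhdsWithin_le_nhds (((continuous_mul_const |t|).tendsto 0).eventually_lt_const (by
        simpa using hμ))
    have c3 : ∀ᶠ r : ℝ in nhdsWithin 0 (Set.Ioi 0), r * (2 * t ^ 2 * G ^ 2) < μ * (t * s) :=
      nhdsWithin_le_nhds (((continuous_mul_const _).tendsto 0).eventually_lt_const (by
        simpa using hden))
    obtain ⟨r, hr, h1, h2, h3⟩ :=
      (eventually_mem_nhdsWithin.and (c1.and (c2.and c3))).exists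
    exact ⟨r, hr, h1.le, h2.le, h3⟩
  have hrt : 0 ≤ γ + r * t := by nlinarith
  set d := quadF A₀ b₀ c₀ x + γ * quadF A₁ b₁ c₁ x with hd
  have hlower : ∀ y, d + (r * (t * s) - 2 * (r * t) ^ 2 * G ^ 2 / μ) ≤
      quadF A₀ b₀ c₀ y + (γ + r * t) * quadF A₁ b₁ c₁ y := fun y => by
    obtain ⟨h, rfl⟩ : ∃ h, y = x + h := ⟨y - x, by simp⟩
    have e1 := quadF_add_of_mulVec_add_eq_zero hM hx (c₀ + γ * c₁) h
    rw [quadF_add_smul, quadF_add_smul] at e1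
    have e2 := le_dotProduct_mulVec_of_le_lambdaMin hμ hlmin h
    have e3 := abs_quadF_add_sub_le hA₁ hA₁n b₁ c₁ x h
    have e4 : -(r * |t| * (2 * G * eNorm h + eNorm h ^ 2)) ≤
        r * t * (quadF A₁ b₁ c₁ (x + h) - s) := by
      refine (abs_le.mp ?_).1
      rw [abs_mul, abs_mul, abs_of_pos hr0]
      exact mul_le_mul_of_nonneg_left e3 (by positivity)
    have e5 : r * |t| * eNorm h ^ 2 ≤ μ / 2 * eNorm h ^ 2 :=
      mul_le_mul_of_nonneg_right hrμ (sq_nonneg _)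
    have e6 : 2 * (r * |t|) * G * eNorm h ≤
        μ / 2 * eNorm h ^ 2 + 2 * (r * t) ^ 2 * G ^ 2 / μ := by
      have : μ / 2 * eNorm h ^ 2 + 2 * (r * t) ^ 2 * G ^ 2 / μ - 2 * (r * |t|) * G * eNorm h =
          (μ * eNorm h - 2 * (r * |t|) * G) ^ 2 / (2 * μ) := by
        rw [mul_pow r t, ← sq_abs t]
        field_simp
        ring
      have : 0 ≤ (μ * eNorm h - 2 * (r * |t|) * G) ^ 2 / (2 * μ) := by positivity
      linarith
    linarith
  have hgain : 0 < r * (t * s) - 2 * (r * t) ^ 2 * G ^ 2 / μ := by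
    rw [sub_pos, div_lt_iff₀ hμ]
    nlinarith [mul_lt_mul_of_pos_left hrs hr0]
  have h1 : ((d + (r * (t * s) - 2 * (r * t) ^ 2 * G ^ 2 / μ) : ℝ) : EReal) ≤
      dualF A₀ A₁ b₀ b₁ c₀ c₁ (γ + r * t) :=
    le_iInf fun y => EReal.coe_le_coe_iff.mpr (hlower y)
  have h2 : dualF A₀ A₁ b₀ b₁ c₀ c₁ γ ≤ (d : EReal) := iInf_le _ x
  have := EReal.coe_le_coe_iff.mp (h1.trans ((hmax _ hrt).trans h2))
  linarith

/-- A gradient bound and a step bound give an `ε` bound on the change of a quadratic. -/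
lemma quadF_add_le_add_of_eNorm_le {n : ℕ} {A : Matrix (Fin n) (Fin n) ℝ} (hA : A.IsSymm)
    (hAn : sNorm A ≤ 1) {b : Fin n → ℝ} (hb : eNorm b ≤ 1) (c : ℝ) {x h : Fin n → ℝ}
    {ζ μ ε : ℝ} (hζ : 1 ≤ ζ) (hμ0 : 0 < μ) (hμ1 : μ ≤ 1) (hε0 : 0 < ε) (hε1 : ε < 1)
    (hx : μ * eNorm x ≤ 2 * ζ) (hh : eNorm h ≤ ε * μ / (10 * ζ)) :
    quadF A b c (x + h) ≤ quadF A b c x + ε := by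
  have h1 := (abs_le.mp (abs_quadF_add_sub_le hA hAn b c x h)).2
  have h2 : eNorm (A *ᵥ x + b) ≤ eNorm x + 1 :=
    (eNorm_add_le _ _).trans (add_le_add (eNorm_mulVec_le_of_sNorm_le_one hAn x) hb)
  rw [le_div_iff₀ (by positivity)] at hh
  have hn := eNorm_nonneg h
  have h3 : eNorm h * (eNorm x + 1) ≤ 3 / 10 * ε := by
    have h4 : (eNorm x + 1) * μ ≤ 3 * ζ := by linarith
    have h5 : eNorm h * ((eNorm x + 1) * μ) ≤ eNorm h * (3 * ζ) :=
      mul_le_mul_of_nonneg_left h4 hn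
    exact le_of_mul_le_mul_right (by nlinarith) hμ0
  have h6 : eNorm h ≤ ε / 10 := by nlinarith
  have h7 : eNorm (A *ᵥ x + b) * eNorm h ≤ (eNorm x + 1) * eNorm h :=
    mul_le_mul_of_nonneg_right h2 hn
  nlinarith

/-- Under Assumption 1 and the stated normalizations, any
`μ̃(εμ̃/(10ζ))²`-optimal solution `x̄` of the strongly convex reformulation
`min_x max(q(γ⁽¹⁾,x), q(γ⁽²⁾,x))` is an `ε`-approximate solution of the GTRS. -/
theorem stmt_13 {n : ℕ} (hn : 0 < n)
    (A₀ A₁ : Matrix (Fin n) (Fin n) ℝ) (hA₀ : A₀.IsSymm) (hA₁ : A₁.IsSymm)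
    (b₀ b₁ : Fin n → ℝ) (c₀ c₁ : ℝ)
    (xsl : Fin n → ℝ) (hxsl : quadF A₁ b₁ c₁ xsl < 0)
    (γbar : ℝ) (hγbar : 0 ≤ γbar) (hpdbar : (A₀ + γbar • A₁).PosDef)
    (hA₀n : sNorm A₀ ≤ 1) (hA₁n : sNorm A₁ ≤ 1)
    (hb₀n : eNorm b₀ ≤ 1) (hb₁n : eNorm b₁ ≤ 1)
    (hc₀ : |c₀| ≤ 1) (hc₁ : |c₁| ≤ 1)
    (ζ : ℝ) (hζ : 1 ≤ ζ)
    (hΓ : {γ : ℝ | 0 ≤ γ ∧ (A₀ + γ • A₁).PosSemidef} ⊆ Set.Icc 0 ζ)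
    (μt : ℝ) (hμt0 : 0 < μt) (hμt1 : μt ≤ 1)
    (ε : ℝ) (hε0 : 0 < ε) (hε1 : ε < 1)
    (γstar : ℝ) (hγstar : 0 ≤ γstar)
    (hmax : ∀ γ : ℝ, 0 ≤ γ →
      dualF A₀ A₁ b₀ b₁ c₀ c₁ γ ≤ dualF A₀ A₁ b₀ b₁ c₀ c₁ γstar)
    (hlmin : μt ≤ lambdaMin (A₀ + γstar • A₁))
    (γ₁ γ₂ : ℝ) (hγ₁0 : 0 ≤ γ₁) (hγ₁ : γ₁ ≤ γstar) (hγ₂ : γstar ≤ γ₂)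
    (xb : Fin n → ℝ)
    (hxb : max (quadF A₀ b₀ c₀ xb + γ₁ * quadF A₁ b₁ c₁ xb)
        (quadF A₀ b₀ c₀ xb + γ₂ * quadF A₁ b₁ c₁ xb) ≤
      sInf (quadF A₀ b₀ c₀ '' {x : Fin n → ℝ | quadF A₁ b₁ c₁ x ≤ 0}) +
        μt * (ε * μt / (10 * ζ)) ^ 2) :
    quadF A₀ b₀ c₀ xb ≤
      sInf (quadF A₀ b₀ c₀ '' {x : Fin n → ℝ | quadF A₁ b₁ c₁ x ≤ 0}) + ε ∧
    quadF A₁ b₁ c₁ xb ≤ ε := by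
  have hM : (A₀ + γstar • A₁).IsSymm := hA₀.add (hA₁.smul γstar)
  have hγζ : γstar ≤ ζ :=
    (hΓ ⟨hγstar, (posDef_of_le_lambdaMin hM hμt0 hlmin).posSemidef⟩).2
  obtain ⟨x, hx, hxn⟩ := exists_mulVec_add_eq_zero hM hμt0 hlmin (b₀ + γstar • b₁)
  have hfeas : quadF A₁ b₁ c₁ x ≤ 0 := by
    simpa using quadF_mul_nonpos_of_dual_max (t := 1) hA₀ hA₁ hA₁n hμt0 hmax hlmin hx hγstar
      (by linarith)
  have hcompl : γstar * quadF A₁ b₁ c₁ x = 0 := by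
    have := quadF_mul_nonpos_of_dual_max (t := -γstar) hA₀ hA₁ hA₁n hμt0 hmax hlmin hx hγstar
      (by linarith)
    nlinarith [mul_nonpos_of_nonneg_of_nonpos hγstar hfeas]
  have hgrowth : ∀ h, quadF A₀ b₀ c₀ x + μt * eNorm h ^ 2 ≤
      quadF A₀ b₀ c₀ (x + h) + γstar * quadF A₁ b₁ c₁ (x + h) := fun h => by
    have e1 := quadF_add_of_mulVec_add_eq_zero hM hx (c₀ + γstar * c₁) h
    rw [quadF_add_smul, quadF_add_smul] at e1
    linarith [le_dotProduct_mulVec_of_le_lambdaMin hμt0 hlmin h]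
  have hopt : sInf (quadF A₀ b₀ c₀ '' {x : Fin n → ℝ | quadF A₁ b₁ c₁ x ≤ 0}) =
      quadF A₀ b₀ c₀ x := by
    refine IsLeast.csInf_eq ⟨⟨x, hfeas, rfl⟩, ?_⟩
    rintro _ ⟨y, hy, rfl⟩
    have h1 := hgrowth (y - x)
    rw [add_sub_cancel] at h1
    have h2 := mul_nonpos_of_nonneg_of_nonpos hγstar hy
    have : 0 ≤ μt * eNorm (y - x) ^ 2 := by positivity
    linarith
  obtain ⟨h, rfl⟩ : ∃ h, xb = x + h := ⟨xb - x, by simp⟩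
  rw [hopt] at hxb ⊢
  have hmid : quadF A₀ b₀ c₀ (x + h) + γstar * quadF A₁ b₁ c₁ (x + h) ≤
      quadF A₀ b₀ c₀ x + μt * (ε * μt / (10 * ζ)) ^ 2 := by
    have ⟨h1, h2⟩ := max_le_iff.mp hxb
    rcases le_total 0 (quadF A₁ b₁ c₁ (x + h)) with hq | hq
    · linarith [mul_le_mul_of_nonneg_right hγ₂ hq]
    · linarith [mul_le_mul_of_nonpos_right hγ₁ hq]
  have hh : eNorm h ≤ ε * μt / (10 * ζ) := by
    refine le_of_sq_le_sq ?_ (by positivity)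
    exact le_of_mul_le_mul_left (by linarith [hgrowth h]) hμt0
  have hxn' : μt * eNorm x ≤ 2 * ζ := by
    have h1 := eNorm_add_le b₀ (γstar • b₁)
    rw [eNorm_smul, abs_of_nonneg hγstar] at h1
    linarith [mul_le_of_le_one_right hγstar hb₁n]
  refine ⟨quadF_add_le_add_of_eNorm_le hA₀ hA₀n hb₀n c₀ hζ hμt0 hμt1 hε0 hε1 hxn' hh, ?_⟩
  linarith [quadF_add_le_add_of_eNorm_le hA₁ hA₁n hb₁n c₁ hζ hμt0 hμt1 hε0 hε1 hxn' hh]
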